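/- arXiv:math/0310272 — 2 statements merged into one kernel-verified Lean document; each statement's English description precedes it below -/
import Mathlib

section
/- Cut-and-join eigenfunction identity: let d be a positive integer and χ an irreducible complex character of S_d. In the polynomial ring ℂ[p_1, p_2, …] (variables indexed by positive integers), set P_χ = Σ_{μ a partition of d} (χ(σ_μ)/z_μ) · p_{μ_1} p_{μ_2} ⋯ p_{μ_{l(μ)}}. Then f_χ · P_χ = (1/2) · Σ_{i,j ≥ 1} [ (i+j) · p_i p_j · ∂P_χ/∂p_{i+j} + i·j · p_{i+j} · ∂²P_χ/(∂p_i ∂p_j) ] (the sum over ordered pairs (i,j) with i+j ≤ d is finite). -/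
open scoped BigOperators Classical

noncomputable section

namespace DoubleHurwitz

/-- The cycle type of a permutation of `{1, …, d}`, counting fixed points as cycles of
length 1 (Mathlib's `Equiv.Perm.cycleType` records only the nontrivial cycles). -/
def fullCycleType {d : ℕ} (σ : Equiv.Perm (Fin d)) : Multiset ℕ :=
  σ.cycleType + Multiset.replicate (d - σ.cycleType.sum) 1

/-- `σ` has cycle type `μ`, where fixed points count as cycles of length 1. -/
def HasCycleType {d : ℕ} (σ : Equiv.Perm (Fin d)) (μ : Nat.Partition d) : Prop :=
  fullCycleType σ = μ.parts

/-- `z_μ = ∏_{j ≥ 1} m_j(μ)! · j^{m_j(μ)}` where `m_j(μ)` is the number of parts equal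
to `j` (all parts lie in `{1, …, d}`). -/
def zPart {d : ℕ} (μ : Nat.Partition d) : ℕ :=
  ∏ j ∈ Finset.Icc 1 d, Nat.factorial (μ.parts.count j) * j ^ (μ.parts.count j)

/-- `χ : S_d → ℂ` is an irreducible (complex) character: the character of some simple
finite-dimensional complex representation of `S_d`. -/
def IsIrredChar (d : ℕ) (χ : Equiv.Perm (Fin d) → ℂ) : Prop :=
  ∃ V : FDRep ℂ (Equiv.Perm (Fin d)), CategoryTheory.Simple V ∧ χ = V.character

/-- The (finite) type of irreducible complex characters of `S_d`. -/
def IrredChar (d : ℕ) : Type :=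
  {χ : Equiv.Perm (Fin d) → ℂ // IsIrredChar d χ}

/-- `f_χ = (d(d−1)/2)·χ(t)/χ(1)` for any transposition `t`.  Since characters are class
functions and the `d(d−1)/2` transpositions form a single conjugacy class, this value
equals the sum of `χ(t)/χ(1)` over all transpositions `t`, which is how we encode it
(this avoids an arbitrary choice of transposition, and gives `0` when `d = 1`,
matching `d(d−1)/2 = 0`). -/
def fChar {d : ℕ} (χ : Equiv.Perm (Fin d) → ℂ) : ℂ :=
  ∑ t ∈ Finset.univ.filter (fun t : Equiv.Perm (Fin d) => t.IsSwap), χ t / χ 1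

/-- The disconnected double Hurwitz generating function
`Φ•_{μ,ν}(λ) = Σ_χ (χ(σ_μ)/z_μ)·(χ(σ_ν)/z_ν)·e^{f_χ λ}`, the sum ranging over the
irreducible complex characters of `S_d`, where `rep` is a choice of a permutation
`σ_μ = rep μ` of each cycle type `μ`. -/
def Phi {d : ℕ} (rep : Nat.Partition d → Equiv.Perm (Fin d)) (μ ν : Nat.Partition d)
    (lam : ℂ) : ℂ :=
  ∑ᶠ χ : IrredChar d,
    (χ.1 (rep μ) / zPart μ) * (χ.1 (rep ν) / zPart ν) * Complex.exp (fChar χ.1 * lam)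

end DoubleHurwitz

namespace DoubleHurwitz

open CategoryTheory in
/-- By Schur's lemma, a conjugation-invariant sum of group elements acts on a simple
representation as a scalar. -/
theorem exists_sum_rho_eq_smul_one {G : Type} [Group G] (V : FDRep ℂ G) [Simple V]
    (S : Finset G) (hS : ∀ g, ∀ t ∈ S, g * t * g⁻¹ ∈ S) :
    ∃ c : ℂ, ∑ t ∈ S, V.ρ t = c • (1 : V →ₗ[ℂ] V) := by
  have hcomm : ∀ g, (∑ t ∈ S, V.ρ t) * V.ρ g = V.ρ g * ∑ t ∈ S, V.ρ t := by
    intro g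
    rw [Finset.sum_mul, Finset.mul_sum]
    refine (Finset.sum_bij' (fun t _ => g * t * g⁻¹) (fun t _ => g⁻¹ * t * g)
      (fun t ht => hS g t ht) (fun t ht => by simpa using hS g⁻¹ t ht) ?_ ?_ ?_).symm
    · intro t _; group
    · intro t _; group
    · intro t _
      rw [← map_mul, ← map_mul]
      congr 1
      group
  let f : V ⟶ V :=
    { hom := InducedCategory.homMk (ModuleCat.ofHom (∑ t ∈ S, V.ρ t))
      comm := fun g => by
        ext x
        exact LinearMap.congr_fun (hcomm g) x }
  obtain ⟨c, hc⟩ := endomorphism_simple_eq_smul_id ℂ f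
  refine ⟨c, LinearMap.ext fun x => ?_⟩
  have := congrArg (fun h : V ⟶ V => h.hom.hom.hom x) hc
  exact this.symm

theorem isSwap_conj {α : Type*} [DecidableEq α] {t : Equiv.Perm α} (ht : t.IsSwap)
    (g : Equiv.Perm α) : (g * t * g⁻¹).IsSwap := by
  obtain ⟨x, y, hxy, rfl⟩ := ht
  exact ⟨g x, g y, fun h => hxy (g.injective h), (Equiv.swap_apply_apply g x y).symm⟩

theorem sum_char_mul_swap {d : ℕ} {χ : Equiv.Perm (Fin d) → ℂ} (hχ : IsIrredChar d χ)
    (σ : Equiv.Perm (Fin d)) :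
    ∑ t ∈ Finset.univ.filter (fun t : Equiv.Perm (Fin d) => t.IsSwap), χ (σ * t)
      = fChar χ * χ σ := by
  obtain ⟨V, hV, rfl⟩ := hχ
  obtain ⟨c, hc⟩ := exists_sum_rho_eq_smul_one V
    (Finset.univ.filter (fun t : Equiv.Perm (Fin d) => t.IsSwap))
    (fun g t ht => by simpa using isSwap_conj (by simpa using ht) g)
  have key : ∀ τ : Equiv.Perm (Fin d),
      ∑ t ∈ Finset.univ.filter (fun t : Equiv.Perm (Fin d) => t.IsSwap), V.character (τ * t)
        = c * V.character τ := by
    intro τ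
    have := congrArg (fun f => LinearMap.trace ℂ V (V.ρ τ * f)) hc
    simpa [Finset.mul_sum, FDRep.character, Representation.character] using this
  by_cases h1 : V.character 1 = 0
  · have h0 : ∀ τ, V.character τ = 0 := by
      intro τ
      rw [FDRep.char_one, Nat.cast_eq_zero, Module.finrank_zero_iff] at h1
      have : V.ρ τ = 0 := LinearMap.ext fun x => Subsingleton.elim _ _
      simp [FDRep.character, this]
    simp [h0]
  · have := key 1
    simp only [one_mul] at this
    rw [key, fChar, ← Finset.sum_div, this, mul_div_cancel_right₀ _ h1]

theorem char_eq_of_cycleType_eq {d : ℕ} {χ : Equiv.Perm (Fin d) → ℂ} (hχ : IsIrredChar d χ)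
    {σ τ : Equiv.Perm (Fin d)} (h : σ.cycleType = τ.cycleType) : χ σ = χ τ := by
  obtain ⟨V, hV, rfl⟩ := hχ
  obtain ⟨g, rfl⟩ := isConj_iff.1 (Equiv.Perm.isConj_iff_cycleType_eq.2 h)
  rw [FDRep.char_conj]

theorem filter_fullCycleType {d : ℕ} (σ : Equiv.Perm (Fin d)) :
    (fullCycleType σ).filter (2 ≤ ·) = σ.cycleType := by
  rw [fullCycleType, Multiset.filter_add, Multiset.filter_eq_self.2, Multiset.filter_eq_nil.2,
    add_zero]
  · intro a ha
    rw [Multiset.eq_of_mem_replicate ha]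
    norm_num
  · exact fun a ha => Equiv.Perm.two_le_of_mem_cycleType ha

theorem fullCycleType_eq_iff {d : ℕ} {σ τ : Equiv.Perm (Fin d)} :
    fullCycleType σ = fullCycleType τ ↔ σ.cycleType = τ.cycleType := by
  refine ⟨fun h => ?_, fun h => by rw [fullCycleType, fullCycleType, h]⟩
  rw [← filter_fullCycleType σ, h, filter_fullCycleType]

/-- The number of permutations of cycle type `μ` is `d! / z_μ`. -/
theorem card_fullCycleType_mul_zPart {d : ℕ} (μ : Nat.Partition d) (σ₀ : Equiv.Perm (Fin d))
    (h₀ : HasCycleType σ₀ μ) :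
    (Finset.univ.filter fun σ : Equiv.Perm (Fin d) => fullCycleType σ = μ.parts).card * zPart μ
      = d.factorial := by
  rw [HasCycleType] at h₀
  have hle : σ₀.cycleType.sum ≤ d := by simpa using σ₀.sum_cycleType_le
  have hz : zPart μ = (d - σ₀.cycleType.sum).factorial * σ₀.cycleType.prod *
      ∏ n ∈ σ₀.cycleType.toFinset, (σ₀.cycleType.count n).factorial := by
    have hc1 : μ.parts.count 1 = d - σ₀.cycleType.sum := by
      rw [← h₀, fullCycleType, Multiset.count_add, Multiset.count_replicate_self,
        Multiset.count_eq_zero.2, zero_add]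
      exact fun h => absurd (Equiv.Perm.two_le_of_mem_cycleType h) (by norm_num)
    have hcn : ∀ n, n ≠ 1 → μ.parts.count n = σ₀.cycleType.count n := by
      intro n hn
      rw [← h₀, fullCycleType, Multiset.count_add, Multiset.count_replicate, if_neg (Ne.symm hn),
        add_zero]
    have hsub : σ₀.cycleType.toFinset ⊆ (Finset.Icc 1 d).erase 1 := by
      intro n hn
      rw [Multiset.mem_toFinset] at hn
      have h2 := Equiv.Perm.two_le_of_mem_cycleType hn
      have h3 := (Multiset.le_sum_of_mem hn).trans hle
      simp only [Finset.mem_erase, Finset.mem_Icc]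
      omega
    have hrest : ∏ j ∈ (Finset.Icc 1 d).erase 1,
          (μ.parts.count j).factorial * j ^ (μ.parts.count j)
        = σ₀.cycleType.prod *
          ∏ n ∈ σ₀.cycleType.toFinset, (σ₀.cycleType.count n).factorial := by
      rw [Finset.prod_multiset_count, ← Finset.prod_mul_distrib]
      symm
      rw [← Finset.prod_subset hsub]
      · refine Finset.prod_congr rfl fun n hn => ?_
        rw [hcn n (Finset.ne_of_mem_erase (hsub hn)), mul_comm]
      · intro n hn hn'
        rw [hcn n (Finset.ne_of_mem_erase hn), Multiset.count_eq_zero.2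
          (by rwa [Multiset.mem_toFinset] at hn')]
        simp
    rw [mul_assoc, ← hrest, zPart]
    by_cases hd : 1 ∈ Finset.Icc 1 d
    · rw [← Finset.mul_prod_erase _ _ hd, hc1]
      simp
    · have : d = 0 := by simpa using hd
      subst this
      simp
  have := Equiv.Perm.card_of_cycleType_mul_eq (Fin d) σ₀.cycleType
  rw [if_pos ⟨by simpa using hle, fun a ha => Equiv.Perm.two_le_of_mem_cycleType ha⟩,
    Fintype.card_fin, ← hz] at this
  rw [← this]
  congr 2
  ext σ
  simp only [Finset.mem_filter, Finset.mem_univ, true_and]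
  rw [← h₀, fullCycleType_eq_iff]

theorem injOn_pow_apply {α : Type*} (σ : Equiv.Perm α) (a : α) :
    Set.InjOn (fun j => (σ ^ j) a) (Finset.range (Function.minimalPeriod σ a)) := by
  intro i hi j hj h
  simp only [← Equiv.Perm.iterate_eq_pow] at h
  exact Function.iterate_injOn_Iio_minimalPeriod (by simpa using hi) (by simpa using hj) h

section Cycles

variable {α : Type*} [Fintype α] [DecidableEq α]

/-- The orbit of `a` under the permutation `σ`. -/
def cyc (σ : Equiv.Perm α) (a : α) : Finset α :=
  Finset.univ.filter fun b => σ.SameCycle a b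

/-- The set of orbits of the permutation `σ`, fixed points included. -/
def cycles (σ : Equiv.Perm α) : Finset (Finset α) :=
  Finset.univ.image (cyc σ)

theorem mem_cyc {σ : Equiv.Perm α} {a b : α} : b ∈ cyc σ a ↔ σ.SameCycle a b := by
  simp [cyc]

theorem self_mem_cyc (σ : Equiv.Perm α) (a : α) : a ∈ cyc σ a :=
  mem_cyc.2 (Equiv.Perm.SameCycle.refl σ a)

theorem cyc_mem_cycles (σ : Equiv.Perm α) (a : α) : cyc σ a ∈ cycles σ :=
  Finset.mem_image_of_mem _ (Finset.mem_univ a)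

theorem cyc_eq_cyc_iff {σ : Equiv.Perm α} {a b : α} :
    cyc σ a = cyc σ b ↔ σ.SameCycle a b := by
  refine ⟨fun h => mem_cyc.1 (h ▸ self_mem_cyc σ b), fun h => ?_⟩
  ext x
  rw [mem_cyc, mem_cyc]
  exact ⟨fun hx => h.symm.trans hx, fun hx => h.trans hx⟩

theorem eq_cyc_of_mem {σ : Equiv.Perm α} {s : Finset α} (hs : s ∈ cycles σ) {a : α}
    (ha : a ∈ s) : cyc σ a = s := by
  obtain ⟨b, -, rfl⟩ := Finset.mem_image.1 hs
  exact cyc_eq_cyc_iff.2 (mem_cyc.1 ha).symm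

theorem card_pos_of_mem_cycles {σ : Equiv.Perm α} {s : Finset α} (hs : s ∈ cycles σ) :
    0 < s.card := by
  obtain ⟨b, -, rfl⟩ := Finset.mem_image.1 hs
  exact Finset.card_pos.2 ⟨b, self_mem_cyc σ b⟩

theorem disjoint_of_mem_cycles {σ : Equiv.Perm α} {s t : Finset α} (hs : s ∈ cycles σ)
    (ht : t ∈ cycles σ) (hst : s ≠ t) : Disjoint s t :=
  Finset.disjoint_left.2 fun _ hxs hxt =>
    hst ((eq_cyc_of_mem hs hxs).symm.trans (eq_cyc_of_mem ht hxt))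

/-- Summing a function of the orbit over all points counts each orbit as often as its size. -/
theorem sum_comp_cyc {M : Type*} [AddCommMonoid M] (σ : Equiv.Perm α) (g : Finset α → M) :
    ∑ a, g (cyc σ a) = ∑ s ∈ cycles σ, s.card • g s := by
  rw [Finset.sum_comp g (cyc σ)]
  refine Finset.sum_congr rfl fun s hs => ?_
  congr 2
  ext a
  simp only [Finset.mem_filter, Finset.mem_univ, true_and]
  exact ⟨fun h => h ▸ self_mem_cyc σ a, fun h => eq_cyc_of_mem hs h⟩

/-- A permutation preserving a set containing `a` keeps the whole orbit of `a` in that set. -/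
theorem cyc_subset_of_forall {σ : Equiv.Perm α} {a : α} {s : Finset α} (ha : a ∈ s)
    (hs : ∀ x ∈ s, σ x ∈ s) : cyc σ a ⊆ s := by
  intro x hx
  obtain ⟨n, rfl⟩ := (mem_cyc.1 hx).exists_nat_pow_eq
  clear hx
  induction n with
  | zero => simpa using ha
  | succ n ih => rw [pow_succ', Equiv.Perm.mul_apply]; exact hs _ ih

theorem sameCycle_mul_swap_of_mem {σ : Equiv.Perm α} {a b : α} (hab : ¬ σ.SameCycle a b)
    {x : α} (hx : σ.SameCycle b x) : (σ * Equiv.swap a b).SameCycle a x := by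
  set τ := σ * Equiv.swap a b with hτ
  have hstep : ∀ n : ℕ, τ.SameCycle a ((σ ^ (n + 1)) b) := by
    intro n
    induction n with
    | zero =>
      have : τ a = (σ ^ (0 + 1)) b := by simp [hτ]
      rw [← this, Equiv.Perm.sameCycle_apply_right]
    | succ n ih =>
      rw [pow_succ', Equiv.Perm.mul_apply]
      set y := (σ ^ (n + 1)) b with hy
      have hya : y ≠ a := by
        intro h
        apply hab
        rw [← h, hy, Equiv.Perm.sameCycle_pow_left]
      by_cases hyb : y = b
      · have : τ a = σ y := by simp [hτ, hyb]
        rw [← this, Equiv.Perm.sameCycle_apply_right]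
      · have : τ y = σ y := by simp [hτ, Equiv.swap_apply_of_ne_of_ne hya hyb]
        rw [← this, Equiv.Perm.sameCycle_apply_right]
        exact ih
  have hx' : σ.SameCycle (σ b) x := by rwa [Equiv.Perm.sameCycle_apply_left]
  obtain ⟨n, rfl⟩ := hx'.exists_nat_pow_eq
  have := hstep n
  rwa [pow_succ, Equiv.Perm.mul_apply] at this

theorem cyc_mul_swap_self {σ : Equiv.Perm α} {a b : α} (hab : ¬ σ.SameCycle a b) :
    cyc (σ * Equiv.swap a b) a = cyc σ a ∪ cyc σ b := by
  apply Finset.Subset.antisymm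
  · refine cyc_subset_of_forall (Finset.mem_union_left _ (self_mem_cyc σ a)) fun x hx => ?_
    rw [Equiv.Perm.mul_apply]
    simp only [Finset.mem_union, mem_cyc, Equiv.Perm.sameCycle_apply_right] at hx ⊢
    rcases eq_or_ne x a with rfl | hxa
    · simp [Equiv.Perm.SameCycle.refl]
    rcases eq_or_ne x b with rfl | hxb
    · simp [Equiv.Perm.SameCycle.refl]
    rwa [Equiv.swap_apply_of_ne_of_ne hxa hxb]
  · intro x hx
    rw [mem_cyc]
    rcases Finset.mem_union.1 hx with hx | hx
    · have h1 := sameCycle_mul_swap_of_mem hab (Equiv.Perm.SameCycle.refl σ b)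
      have h2 := sameCycle_mul_swap_of_mem (fun h => hab h.symm) (mem_cyc.1 hx)
      rw [Equiv.swap_comm] at h2
      exact h1.trans h2
    · exact sameCycle_mul_swap_of_mem hab (mem_cyc.1 hx)

theorem cyc_mul_swap_of_not_mem {σ : Equiv.Perm α} {a b x : α} (hxa : ¬ σ.SameCycle a x)
    (hxb : ¬ σ.SameCycle b x) : cyc (σ * Equiv.swap a b) x = cyc σ x := by
  have hstep : ∀ y, σ.SameCycle x y → (σ * Equiv.swap a b) y = σ y := by
    intro y hy
    rw [Equiv.Perm.mul_apply, Equiv.swap_apply_of_ne_of_ne]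
    · rintro rfl; exact hxa hy.symm
    · rintro rfl; exact hxb hy.symm
  apply Finset.Subset.antisymm
  · refine cyc_subset_of_forall (self_mem_cyc σ x) fun y hy => ?_
    rw [hstep y (mem_cyc.1 hy), mem_cyc, Equiv.Perm.sameCycle_apply_right]
    exact mem_cyc.1 hy
  · have : cyc σ x ⊆ cyc σ x ∩ cyc (σ * Equiv.swap a b) x := by
      refine cyc_subset_of_forall (Finset.mem_inter.2 ⟨self_mem_cyc _ x, self_mem_cyc _ x⟩)
        fun y hy => ?_
      simp only [Finset.mem_inter, mem_cyc] at hy ⊢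
      rw [Equiv.Perm.sameCycle_apply_right, ← hstep y hy.1, Equiv.Perm.sameCycle_apply_right]
      exact hy
    exact this.trans Finset.inter_subset_right

/-- Multiplying by a transposition of two points in different cycles joins these cycles. -/
theorem cycles_mul_swap {σ : Equiv.Perm α} {a b : α} (hab : ¬ σ.SameCycle a b) :
    cycles (σ * Equiv.swap a b)
      = insert (cyc σ a ∪ cyc σ b) (((cycles σ).erase (cyc σ a)).erase (cyc σ b)) := by
  have hb : cyc (σ * Equiv.swap a b) b = cyc σ a ∪ cyc σ b := by
    rw [Equiv.swap_comm, cyc_mul_swap_self fun h => hab h.symm, Finset.union_comm]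
  ext s
  simp only [Finset.mem_insert, Finset.mem_erase]
  constructor
  · intro hs
    obtain ⟨x, -, rfl⟩ := Finset.mem_image.1 hs
    by_cases hxa : σ.SameCycle a x
    · left
      rw [← cyc_mul_swap_self hab, cyc_eq_cyc_iff, ← mem_cyc.trans
        Equiv.Perm.sameCycle_comm, cyc_mul_swap_self hab]
      exact Finset.mem_union_left _ (mem_cyc.2 hxa)
    by_cases hxb : σ.SameCycle b x
    · left
      rw [← cyc_mul_swap_self hab, cyc_eq_cyc_iff, ← mem_cyc.trans
        Equiv.Perm.sameCycle_comm, cyc_mul_swap_self hab]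
      exact Finset.mem_union_right _ (mem_cyc.2 hxb)
    right
    rw [cyc_mul_swap_of_not_mem hxa hxb]
    exact ⟨fun h => hxb (cyc_eq_cyc_iff.1 h).symm, fun h => hxa (cyc_eq_cyc_iff.1 h).symm,
      cyc_mem_cycles σ x⟩
  · rintro (rfl | ⟨h1, h2, h3⟩)
    · rw [← cyc_mul_swap_self hab]
      exact cyc_mem_cycles _ _
    · obtain ⟨x, -, rfl⟩ := Finset.mem_image.1 h3
      rw [← cyc_mul_swap_of_not_mem (fun h => h2 (cyc_eq_cyc_iff.2 h.symm))
        (fun h => h1 (cyc_eq_cyc_iff.2 h.symm))]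
      exact cyc_mem_cycles _ _

theorem union_not_mem_cycles (σ : Equiv.Perm α) (a b : α) :
    cyc σ a ∪ cyc σ b ∉ ((cycles σ).erase (cyc σ a)).erase (cyc σ b) := by
  intro h
  simp only [Finset.mem_erase] at h
  exact h.2.1 (eq_cyc_of_mem h.2.2 (Finset.mem_union_left _ (self_mem_cyc σ a))).symm

theorem disjoint_cyc {σ : Equiv.Perm α} {a b : α} (hab : ¬ σ.SameCycle a b) :
    Disjoint (cyc σ a) (cyc σ b) :=
  disjoint_of_mem_cycles (cyc_mem_cycles σ a) (cyc_mem_cycles σ b)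
    fun h => hab (cyc_eq_cyc_iff.1 h)

theorem cyc_eq_image_range (σ : Equiv.Perm α) (a : α) :
    cyc σ a = (Finset.range (Function.minimalPeriod σ a)).image fun j => (σ ^ j) a := by
  have hpos : 0 < Function.minimalPeriod σ a :=
    Function.minimalPeriod_pos_of_mem_periodicPts
      (Function.Injective.mem_periodicPts σ.injective a)
  ext x
  simp only [mem_cyc, Finset.mem_image, Finset.mem_range]
  constructor
  · intro h
    obtain ⟨n, rfl⟩ := h.exists_nat_pow_eq
    refine ⟨n % Function.minimalPeriod σ a, Nat.mod_lt _ hpos, ?_⟩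
    rw [← Equiv.Perm.iterate_eq_pow, ← Equiv.Perm.iterate_eq_pow,
      Function.iterate_mod_minimalPeriod_eq]
  · rintro ⟨j, -, rfl⟩
    exact Equiv.Perm.sameCycle_pow_right.2 (Equiv.Perm.SameCycle.refl σ a)

theorem card_cyc (σ : Equiv.Perm α) (a : α) :
    (cyc σ a).card = Function.minimalPeriod σ a := by
  rw [cyc_eq_image_range, Finset.card_image_of_injOn (injOn_pow_apply σ a), Finset.card_range]

/-- Multiplying by a transposition of two points in the same cycle cuts this cycle: the piece
containing the second point. -/
theorem cyc_mul_swap_pow {σ : Equiv.Perm α} {a : α} {k : ℕ} (hk0 : 0 < k)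
    (hk : k < (cyc σ a).card) :
    cyc (σ * Equiv.swap a ((σ ^ k) a)) ((σ ^ k) a)
      = (Finset.Icc 1 k).image fun j => (σ ^ j) a := by
  rw [card_cyc] at hk
  have hinj : ∀ i j, i ≤ k → j ≤ k → (σ ^ i) a = (σ ^ j) a → i = j := fun i j hi hj h =>
    injOn_pow_apply σ a (by simpa using hi.trans_lt hk) (by simpa using hj.trans_lt hk) h
  set τ := σ * Equiv.swap a ((σ ^ k) a) with hτ
  have hlt : ∀ j, 1 ≤ j → j < k → τ ((σ ^ j) a) = (σ ^ (j + 1)) a := by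
    intro j hj1 hjk
    rw [hτ, Equiv.Perm.mul_apply, Equiv.swap_apply_of_ne_of_ne, pow_succ', Equiv.Perm.mul_apply]
    · intro h
      have := hinj j 0 hjk.le (Nat.zero_le _) (by simpa using h)
      omega
    · intro h
      have := hinj j k hjk.le le_rfl h
      omega
  have hlast : τ ((σ ^ k) a) = (σ ^ 1) a := by simp [hτ]
  apply Finset.Subset.antisymm
  · refine cyc_subset_of_forall
      (Finset.mem_image.2 ⟨k, Finset.mem_Icc.2 ⟨hk0, le_rfl⟩, rfl⟩) fun x hx => ?_
    obtain ⟨j, hj, rfl⟩ := Finset.mem_image.1 hx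
    rw [Finset.mem_Icc] at hj
    rcases hj.2.lt_or_eq with h | rfl
    · exact Finset.mem_image.2 ⟨j + 1, Finset.mem_Icc.2 ⟨by omega, h⟩, (hlt j hj.1 h).symm⟩
    · exact Finset.mem_image.2 ⟨1, Finset.mem_Icc.2 ⟨le_rfl, hk0⟩, hlast.symm⟩
  · intro x hx
    obtain ⟨j, hj, rfl⟩ := Finset.mem_image.1 hx
    rw [Finset.mem_Icc] at hj
    obtain ⟨h1, h2⟩ := hj
    rw [mem_cyc]
    induction j, h1 using Nat.le_induction with
    | base => rw [← hlast, Equiv.Perm.sameCycle_apply_right]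
    | succ j hj1 ih =>
      rw [← hlt j hj1 h2, Equiv.Perm.sameCycle_apply_right]
      exact ih (Finset.mem_image.2 ⟨j, Finset.mem_Icc.2 ⟨hj1, by omega⟩, rfl⟩) (by omega)

theorem card_cyc_mul_swap_pow {σ : Equiv.Perm α} {a : α} {k : ℕ} (hk0 : 0 < k)
    (hk : k < (cyc σ a).card) :
    (cyc (σ * Equiv.swap a ((σ ^ k) a)) ((σ ^ k) a)).card = k := by
  rw [cyc_mul_swap_pow hk0 hk, Finset.card_image_of_injOn, Nat.card_Icc, Nat.add_sub_cancel]
  refine (injOn_pow_apply σ a).mono fun j hj => ?_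
  rw [card_cyc] at hk
  simp only [Finset.coe_Icc, Set.mem_Icc] at hj
  simp only [Finset.coe_range, Set.mem_Iio]
  omega

theorem not_sameCycle_mul_swap_pow {σ : Equiv.Perm α} {a : α} {k : ℕ} (hk0 : 0 < k)
    (hk : k < (cyc σ a).card) :
    ¬ (σ * Equiv.swap a ((σ ^ k) a)).SameCycle a ((σ ^ k) a) := by
  intro h
  have h' := mem_cyc.2 h.symm
  rw [cyc_mul_swap_pow hk0 hk] at h'
  obtain ⟨j, hj, hja⟩ := Finset.mem_image.1 h'
  rw [Finset.mem_Icc] at hj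
  rw [card_cyc] at hk
  have := injOn_pow_apply σ a (by simp; omega : j ∈ _) (by simp; omega : 0 ∈ _)
    (by simpa using hja)
  omega

end Cycles

open MvPolynomial

/-- The product of the variables indexed by the sizes of the given sets. -/
def cardMonomial {α : Type*} (S : Finset (Finset α)) : MvPolynomial ℕ ℂ :=
  ∏ s ∈ S, X s.card

theorem cardMonomial_eq_mul_erase {α : Type*} [DecidableEq α] {S : Finset (Finset α)}
    {s : Finset α} (hs : s ∈ S) :
    cardMonomial S = X s.card * cardMonomial (S.erase s) :=
  (Finset.mul_prod_erase S (fun s => (X s.card : MvPolynomial ℕ ℂ)) hs).symm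

section PowerSum

variable {α : Type*} [Fintype α] [DecidableEq α]

theorem cardMonomial_cycles_join {σ : Equiv.Perm α} {a b : α} (hab : ¬ σ.SameCycle a b) :
    cardMonomial (cycles (σ * Equiv.swap a b))
      = X ((cyc σ a).card + (cyc σ b).card) *
        cardMonomial (((cycles σ).erase (cyc σ a)).erase (cyc σ b)) := by
  rw [cycles_mul_swap hab, cardMonomial, Finset.prod_insert (union_not_mem_cycles σ a b),
    Finset.card_union_of_disjoint (disjoint_cyc hab), cardMonomial]

theorem cardMonomial_cycles_cut {σ : Equiv.Perm α} {a : α} {k : ℕ} (hk0 : 0 < k)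
    (hk : k < (cyc σ a).card) :
    cardMonomial (cycles (σ * Equiv.swap a ((σ ^ k) a)))
      = X k * X ((cyc σ a).card - k) * cardMonomial ((cycles σ).erase (cyc σ a)) := by
  have hcard := card_cyc_mul_swap_pow hk0 hk
  have hab := not_sameCycle_mul_swap_pow hk0 hk
  set b := (σ ^ k) a
  set τ := σ * Equiv.swap a b with hτ
  have hσ : σ = τ * Equiv.swap a b := by simp [hτ, mul_assoc]
  have hcyc : cyc σ a = cyc τ a ∪ cyc τ b := by
    conv_lhs => rw [hσ]
    exact cyc_mul_swap_self hab
  have hsum : (cyc σ a).card = (cyc τ a).card + k := by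
    rw [hcyc, Finset.card_union_of_disjoint (disjoint_cyc hab), hcard]
  have herase : (cycles σ).erase (cyc σ a)
      = ((cycles τ).erase (cyc τ a)).erase (cyc τ b) := by
    rw [hcyc]
    conv_lhs => rw [hσ]
    rw [cycles_mul_swap hab, Finset.erase_insert (union_not_mem_cycles τ a b)]
  have hb : cyc τ b ∈ (cycles τ).erase (cyc τ a) :=
    Finset.mem_erase.2 ⟨fun h => hab (cyc_eq_cyc_iff.1 h).symm, cyc_mem_cycles τ b⟩
  rw [cardMonomial_eq_mul_erase (cyc_mem_cycles τ a), cardMonomial_eq_mul_erase hb, hcard,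
    herase, hsum, Nat.add_sub_cancel]
  ring

theorem sum_cut (σ : Equiv.Perm α) (a : α) :
    ∑ b ∈ (cyc σ a).erase a, cardMonomial (cycles (σ * Equiv.swap a b))
      = (∑ k ∈ Finset.Ioo 0 (cyc σ a).card, X k * X ((cyc σ a).card - k)) *
        cardMonomial ((cycles σ).erase (cyc σ a)) := by
  have himage : (cyc σ a).erase a
      = (Finset.Ioo 0 (cyc σ a).card).image fun k => (σ ^ k) a := by
    have hinj := injOn_pow_apply σ a
    rw [card_cyc]
    conv_lhs => rw [cyc_eq_image_range]
    ext x
    simp only [Finset.mem_erase, Finset.mem_image, Finset.mem_range, Finset.mem_Ioo]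
    constructor
    · rintro ⟨hxa, j, hj, rfl⟩
      refine ⟨j, ⟨Nat.pos_of_ne_zero ?_, hj⟩, rfl⟩
      rintro rfl
      exact hxa (by simp)
    · rintro ⟨j, ⟨hj0, hj⟩, rfl⟩
      refine ⟨fun h => ?_, j, hj, rfl⟩
      have := hinj (by simpa using hj) (by simpa using hj0.trans hj : 0 ∈ _) (by simpa using h)
      omega
  rw [himage, Finset.sum_image, Finset.sum_mul]
  · refine Finset.sum_congr rfl fun k hk => ?_
    rw [Finset.mem_Ioo] at hk
    exact cardMonomial_cycles_cut hk.1 hk.2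
  · refine (injOn_pow_apply σ a).mono fun j hj => ?_
    rw [card_cyc] at hj
    simp only [Finset.coe_Ioo, Set.mem_Ioo] at hj
    simpa using hj.2

theorem sum_join (σ : Equiv.Perm α) (a : α) :
    ∑ b ∈ Finset.univ \ cyc σ a, cardMonomial (cycles (σ * Equiv.swap a b))
      = ∑ t ∈ (cycles σ).erase (cyc σ a), t.card •
          (X ((cyc σ a).card + t.card) *
            cardMonomial (((cycles σ).erase (cyc σ a)).erase t)) := by
  have h1 : Finset.univ \ cyc σ a = Finset.univ.filter fun b => cyc σ b ≠ cyc σ a := by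
    ext b
    simp only [Finset.mem_sdiff, Finset.mem_univ, true_and, Finset.mem_filter, mem_cyc, ne_eq,
      cyc_eq_cyc_iff, Equiv.Perm.sameCycle_comm]
  have h2 : (cycles σ).erase (cyc σ a) = (cycles σ).filter fun t => t ≠ cyc σ a := by
    ext t
    simp [and_comm]
  rw [h1]
  conv_rhs => rw [h2, Finset.sum_filter]
  have h3 := sum_comp_cyc σ fun t => if t ≠ cyc σ a then
      (X ((cyc σ a).card + t.card) * cardMonomial (((cycles σ).erase (cyc σ a)).erase t) :
        MvPolynomial ℕ ℂ) else 0
  simp only [smul_ite, smul_zero] at h3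
  rw [← h2, ← h3, Finset.sum_filter]
  refine Finset.sum_congr rfl fun b _ => ?_
  split_ifs with h
  · exact cardMonomial_cycles_join fun hab => h (cyc_eq_cyc_iff.2 hab.symm)
  · rfl

/-- Cut and join: the effect on cycle lengths of multiplying by all transpositions. -/
theorem sum_mul_swap (σ : Equiv.Perm α) :
    ∑ a, ∑ b ∈ Finset.univ.erase a, cardMonomial (cycles (σ * Equiv.swap a b))
      = ∑ s ∈ cycles σ, s.card •
          ((∑ k ∈ Finset.Ioo 0 s.card, X k * X (s.card - k)) *
            cardMonomial ((cycles σ).erase s)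
          + ∑ t ∈ (cycles σ).erase s, t.card •
              (X (s.card + t.card) * cardMonomial (((cycles σ).erase s).erase t))) := by
  rw [← sum_comp_cyc]
  refine Finset.sum_congr rfl fun a _ => ?_
  rw [← sum_cut, ← sum_join, add_comm, ← Finset.sum_sdiff (Finset.erase_subset_erase a
    (Finset.subset_univ (cyc σ a)))]
  congr 1
  refine Finset.sum_congr ?_ fun _ _ => rfl
  ext b
  simp only [Finset.mem_sdiff, Finset.mem_erase, Finset.mem_univ, and_true, not_and, true_and]
  constructor
  · exact fun h => h.2 h.1
  · exact fun h => ⟨fun hba => h (hba ▸ self_mem_cyc σ b), fun _ => h⟩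

theorem sum_swap_eq {M : Type*} [AddCommMonoid M] (F : Equiv.Perm α → M) :
    ∑ a, ∑ b ∈ Finset.univ.erase a, F (Equiv.swap a b)
      = 2 • ∑ t ∈ Finset.univ.filter (fun t : Equiv.Perm α => t.IsSwap), F t := by
  have h1 : ∑ a, ∑ b ∈ Finset.univ.erase a, F (Equiv.swap a b)
      = ∑ p ∈ (Finset.univ : Finset α).offDiag, F (Equiv.swap p.1 p.2) := by
    rw [Finset.sum_sigma']
    refine Finset.sum_bij' (fun p _ => (p.1, p.2)) (fun p _ => ⟨p.1, p.2⟩) ?_ ?_ ?_ ?_ ?_ <;>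
      simp [eq_comm]
  have h2 : (Finset.univ : Finset α).offDiag.image (fun p => Equiv.swap p.1 p.2)
      = Finset.univ.filter (fun t : Equiv.Perm α => t.IsSwap) := by
    ext t
    simp only [Finset.mem_image, Finset.mem_offDiag, Finset.mem_univ, true_and, Prod.exists,
      Finset.mem_filter]
    exact ⟨fun ⟨a, b, h, e⟩ => ⟨a, b, h, e.symm⟩, fun ⟨a, b, h, e⟩ => ⟨a, b, h, e.symm⟩⟩
  rw [h1, Finset.sum_comp F, h2, Finset.smul_sum]
  refine Finset.sum_congr rfl fun t ht => ?_
  congr 1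
  obtain ⟨x, y, hxy, rfl⟩ := (Finset.mem_filter.1 ht).2
  rw [Finset.card_eq_two]
  refine ⟨(x, y), (y, x), by simp [hxy], ?_⟩
  ext ⟨a, b⟩
  simp only [Finset.mem_filter, Finset.mem_offDiag, Finset.mem_univ, true_and, Finset.mem_insert,
    Finset.mem_singleton, Prod.mk.injEq]
  constructor
  · rintro ⟨hab, h⟩
    have h3 := Equiv.congr_fun h a
    rw [Equiv.swap_apply_left, Equiv.swap_apply_def] at h3
    split_ifs at h3 with h4 h5
    · exact Or.inl ⟨h4, h3⟩
    · exact Or.inr ⟨h5, h3⟩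
    · exact absurd h3.symm hab
  · rintro (⟨rfl, rfl⟩ | ⟨rfl, rfl⟩)
    · exact ⟨hxy, rfl⟩
    · exact ⟨hxy.symm, Equiv.swap_comm _ _⟩

theorem cycles_eq_union (σ : Equiv.Perm α) :
    cycles σ = σ.cycleFactorsFinset.image Equiv.Perm.support
      ∪ (Finset.univ \ σ.support).image fun a => {a} := by
  have hfix : ∀ a, σ a = a → cyc σ a = {a} := by
    intro a ha
    refine Finset.Subset.antisymm (cyc_subset_of_forall (by simp) fun x hx => ?_)
      (by simpa using self_mem_cyc σ a)
    rw [Finset.mem_singleton] at hx ⊢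
    rw [hx, ha]
  have hmove : ∀ a, σ a ≠ a → cyc σ a = (σ.cycleOf a).support := by
    intro a ha
    ext x
    rw [mem_cyc, Equiv.Perm.mem_support_cycleOf_iff' ha]
  ext s
  simp only [Finset.mem_union, Finset.mem_image, Finset.mem_sdiff, Finset.mem_univ, true_and,
    Equiv.Perm.mem_support, not_not]
  constructor
  · intro hs
    obtain ⟨a, -, rfl⟩ := Finset.mem_image.1 hs
    by_cases ha : σ a = a
    · exact Or.inr ⟨a, ha, (hfix a ha).symm⟩
    · exact Or.inl ⟨σ.cycleOf a, Equiv.Perm.cycleOf_mem_cycleFactorsFinset_iff.2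
        (Equiv.Perm.mem_support.2 ha), (hmove a ha).symm⟩
  · rintro (⟨c, hc, rfl⟩ | ⟨a, ha, rfl⟩)
    · obtain ⟨a, ha⟩ := (Equiv.Perm.mem_cycleFactorsFinset_iff.1 hc).1.nonempty_support
      have h := Equiv.Perm.cycle_is_cycleOf ha hc
      have hmem : σ a ≠ a := by
        rw [h] at hc
        exact Equiv.Perm.mem_support.1 (Equiv.Perm.cycleOf_mem_cycleFactorsFinset_iff.1 hc)
      rw [h, ← hmove a hmem]
      exact cyc_mem_cycles σ a
    · rw [← hfix a ha]
      exact cyc_mem_cycles σ a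

end PowerSum

theorem cardMonomial_cycles {d : ℕ} (σ : Equiv.Perm (Fin d)) :
    cardMonomial (cycles σ)
      = ((fullCycleType σ).map fun i => (X i : MvPolynomial ℕ ℂ)).prod := by
  rw [cycles_eq_union, cardMonomial, Finset.prod_union, Finset.prod_image, Finset.prod_image,
    fullCycleType, Multiset.map_add, Multiset.prod_add, Equiv.Perm.cycleType_def,
    Multiset.map_map]
  · congr 1
    have : (Finset.univ \ σ.support).card = d - σ.support.card := by
      rw [Finset.card_sdiff_of_subset (Finset.subset_univ _), Finset.card_univ, Fintype.card_fin]
    rw [← Equiv.Perm.cycleType_def, Equiv.Perm.sum_cycleType]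
    simp [this]
  · intro a _ b _ h
    simpa using h
  · intro c hc c' hc' h
    by_contra hne
    have hd := (σ.cycleFactorsFinset_pairwise_disjoint hc hc' hne).disjoint_support
    have hn := (Equiv.Perm.mem_cycleFactorsFinset_iff.1 hc).1.nonempty_support
    rw [← h, disjoint_self] at hd
    exact hn.ne_empty hd
  · rw [Finset.disjoint_left]
    intro s hs hs'
    obtain ⟨c, hc, rfl⟩ := Finset.mem_image.1 hs
    obtain ⟨a, -, ha⟩ := Finset.mem_image.1 hs'
    have := (Equiv.Perm.mem_cycleFactorsFinset_iff.1 hc).1.two_le_card_support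
    rw [← ha, Finset.card_singleton] at this
    omega

theorem pderiv_prod_X {ι : Type*} [DecidableEq ι] (S : Finset ι) (w : ι → ℕ) (n : ℕ) :
    pderiv n (∏ s ∈ S, (X (w s) : MvPolynomial ℕ ℂ))
      = ∑ s ∈ S, if w s = n then ∏ t ∈ S.erase s, X (w t) else 0 := by
  induction S using Finset.induction_on with
  | empty => simp
  | insert a S ha ih =>
    rw [Finset.prod_insert ha, Derivation.leibniz, ih, Finset.sum_insert ha, pderiv_X,
      Finset.erase_insert ha, smul_eq_mul, smul_eq_mul, add_comm, Finset.mul_sum]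
    congr 1
    · by_cases h : w a = n <;> simp [h]
    · refine Finset.sum_congr rfl fun s hs => ?_
      have hsa : s ≠ a := fun h => ha (h ▸ hs)
      rw [mul_ite, mul_zero, Finset.erase_insert_of_ne hsa.symm,
        Finset.prod_insert fun h => ha (Finset.mem_of_mem_erase h)]

/-- The ordered pairs of positive integers with sum at most `d`. -/
def pairs (d : ℕ) : Finset (ℕ × ℕ) :=
  (Finset.Icc 1 d ×ˢ Finset.Icc 1 d).filter (fun ij => ij.1 + ij.2 ≤ d)

theorem mem_pairs {d i j : ℕ} : (i, j) ∈ pairs d ↔ 1 ≤ i ∧ 1 ≤ j ∧ i + j ≤ d := by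
  simp only [pairs, Finset.mem_filter, Finset.mem_product, Finset.mem_Icc]
  omega

/-- Twice the cut-and-join operator. -/
def cutJoin (d : ℕ) : MvPolynomial ℕ ℂ →ₗ[ℂ] MvPolynomial ℕ ℂ where
  toFun P := ∑ ij ∈ pairs d,
    (C ((ij.1 + ij.2 : ℕ) : ℂ) * X ij.1 * X ij.2 * pderiv (ij.1 + ij.2) P
      + C ((ij.1 * ij.2 : ℕ) : ℂ) * X (ij.1 + ij.2) * pderiv ij.1 (pderiv ij.2 P))
  map_add' P Q := by
    rw [← Finset.sum_add_distrib]
    refine Finset.sum_congr rfl fun ij _ => ?_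
    simp only [map_add]
    ring
  map_smul' c P := by
    rw [Finset.smul_sum]
    refine Finset.sum_congr rfl fun ij _ => ?_
    simp only [Derivation.map_smul, RingHom.id_apply]
    simp only [smul_eq_C_mul]
    ring

theorem sum_pairs_cut {d n : ℕ} (hn : n ≤ d) :
    ∑ ij ∈ pairs d, (if n = ij.1 + ij.2 then
        C ((ij.1 + ij.2 : ℕ) : ℂ) * X ij.1 * X ij.2 else 0 : MvPolynomial ℕ ℂ)
      = n • ∑ k ∈ Finset.Ioo 0 n, X k * X (n - k) := by
  rw [← Finset.sum_filter, Finset.smul_sum]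
  refine Finset.sum_bij' (fun ij _ => ij.1) (fun k _ => (k, n - k)) ?_ ?_ ?_ ?_ ?_
  · rintro ⟨i, j⟩ h
    simp only [Finset.mem_filter, mem_pairs] at h
    simp only [Finset.mem_Ioo]
    omega
  · intro k hk
    simp only [Finset.mem_Ioo] at hk
    simp only [Finset.mem_filter, mem_pairs]
    omega
  · rintro ⟨i, j⟩ h
    simp only [Finset.mem_filter, mem_pairs] at h
    simp only [Prod.mk.injEq, true_and]
    omega
  · intro k _
    rfl
  · rintro ⟨i, j⟩ h
    simp only [Finset.mem_filter, mem_pairs] at h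
    obtain ⟨-, rfl⟩ := h
    rw [nsmul_eq_mul, Nat.add_sub_cancel_left, map_natCast]
    ring

theorem cutJoin_prod_X {ι : Type*} [DecidableEq ι] (d : ℕ) (S : Finset ι) (w : ι → ℕ)
    (hpos : ∀ s ∈ S, 0 < w s) (hle : ∀ s ∈ S, w s ≤ d)
    (hle₂ : ∀ s ∈ S, ∀ t ∈ S, s ≠ t → w s + w t ≤ d) :
    cutJoin d (∏ s ∈ S, X (w s))
      = ∑ s ∈ S, w s •
          ((∑ k ∈ Finset.Ioo 0 (w s), X k * X (w s - k)) * ∏ u ∈ S.erase s, X (w u)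
          + ∑ t ∈ S.erase s, w t •
              (X (w s + w t) * ∏ u ∈ (S.erase s).erase t, X (w u))) := by
  simp only [smul_add, Finset.sum_add_distrib]
  change ∑ ij ∈ pairs d, _ = _
  rw [Finset.sum_add_distrib]
  congr 1
  · simp only [pderiv_prod_X, Finset.mul_sum]
    rw [Finset.sum_comm]
    refine Finset.sum_congr rfl fun s hs => ?_
    rw [← smul_mul_assoc, ← sum_pairs_cut (hle s hs), Finset.sum_mul]
    refine Finset.sum_congr rfl fun ij _ => ?_
    split_ifs <;> ring
  · have hderiv : ∀ i j, pderiv i (pderiv j (∏ s ∈ S, (X (w s) : MvPolynomial ℕ ℂ)))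
        = ∑ s ∈ S, ∑ t ∈ S.erase s, if (i, j) = (w t, w s) then
            ∏ u ∈ (S.erase s).erase t, X (w u) else 0 := by
      intro i j
      rw [pderiv_prod_X, map_sum]
      refine Finset.sum_congr rfl fun s _ => ?_
      by_cases h : w s = j
      · rw [if_pos h, pderiv_prod_X]
        simp [h, eq_comm]
      · rw [if_neg h, map_zero]
        simp [Ne.symm h]
    simp only [hderiv, Finset.mul_sum]
    rw [Finset.sum_comm]
    refine Finset.sum_congr rfl fun s hs => ?_
    rw [Finset.sum_comm, Finset.smul_sum]
    refine Finset.sum_congr rfl fun t ht => ?_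
    have hts := Finset.ne_of_mem_erase ht
    have ht' := Finset.mem_of_mem_erase ht
    have hmem : (w t, w s) ∈ pairs d :=
      mem_pairs.2 ⟨hpos t ht', hpos s hs, hle₂ t ht' s hs hts⟩
    rw [Finset.sum_eq_single_of_mem _ hmem]
    · rw [if_pos rfl, map_natCast, nsmul_eq_mul, nsmul_eq_mul, add_comm (w t)]
      push_cast
      ring
    · intro ij _ hij
      rw [if_neg hij, mul_zero]

theorem cutJoin_cardMonomial_cycles {d : ℕ} (σ : Equiv.Perm (Fin d)) :
    cutJoin d (cardMonomial (cycles σ))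
      = 2 • ∑ t ∈ Finset.univ.filter (fun t : Equiv.Perm (Fin d) => t.IsSwap),
          cardMonomial (cycles (σ * t)) := by
  rw [← sum_swap_eq fun t => cardMonomial (cycles (σ * t)), sum_mul_swap]
  refine cutJoin_prod_X d (cycles σ) Finset.card (fun s hs => card_pos_of_mem_cycles hs)
    (fun s _ => by simpa using s.card_le_univ) fun s hs t ht hst => ?_
  rw [← Finset.card_union_of_disjoint (disjoint_of_mem_cycles hs ht hst)]
  simpa using (s ∪ t).card_le_univ

/-- The full cycle type of a permutation, as a partition. -/
def cyclePartition {d : ℕ} (σ : Equiv.Perm (Fin d)) : Nat.Partition d where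
  parts := fullCycleType σ
  parts_pos {i} hi := by
    rcases Multiset.mem_add.1 hi with h | h
    · exact zero_lt_two.trans_le (Equiv.Perm.two_le_of_mem_cycleType h)
    · rw [Multiset.eq_of_mem_replicate h]
      exact one_pos
  parts_sum := by
    have : σ.cycleType.sum ≤ d := by simpa using σ.sum_cycleType_le
    rw [fullCycleType, Multiset.sum_add, Multiset.sum_replicate, smul_eq_mul]
    omega

/-- The characteristic map: the partition sum is an average over the symmetric group. -/
theorem sum_partition_eq {d : ℕ} (rep : Nat.Partition d → Equiv.Perm (Fin d))
    (hrep : ∀ μ : Nat.Partition d, HasCycleType (rep μ) μ)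
    {χ : Equiv.Perm (Fin d) → ℂ} (hχ : IsIrredChar d χ) :
    ∑ μ : Nat.Partition d,
        C (χ (rep μ) / (zPart μ : ℂ)) * (μ.parts.map fun i => (X i : MvPolynomial ℕ ℂ)).prod
      = (d.factorial : ℂ)⁻¹ • ∑ σ, χ σ • cardMonomial (cycles σ) := by
  rw [← Finset.sum_fiberwise_of_maps_to (t := Finset.univ) (g := cyclePartition)
    (fun _ _ => Finset.mem_univ _), Finset.smul_sum]
  refine Finset.sum_congr rfl fun μ _ => ?_
  have hfib : Finset.univ.filter (fun σ => cyclePartition σ = μ)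
      = Finset.univ.filter fun σ : Equiv.Perm (Fin d) => fullCycleType σ = μ.parts := by
    ext σ
    simp [Nat.Partition.ext_iff, cyclePartition]
  have hterm : ∀ σ ∈ Finset.univ.filter fun σ : Equiv.Perm (Fin d) => fullCycleType σ = μ.parts,
      χ σ • cardMonomial (cycles σ)
        = χ (rep μ) • (μ.parts.map fun i => (X i : MvPolynomial ℕ ℂ)).prod := by
    intro σ hσ
    have hσ' := (Finset.mem_filter.1 hσ).2
    rw [cardMonomial_cycles, hσ', char_eq_of_cycleType_eq hχ
      (fullCycleType_eq_iff.1 (hσ'.trans (hrep μ).symm))]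
  have hcard := card_fullCycleType_mul_zPart μ (rep μ) (hrep μ)
  rw [hfib, Finset.sum_congr rfl hterm, Finset.sum_const, ← Nat.cast_smul_eq_nsmul ℂ, smul_smul,
    smul_smul, smul_eq_C_mul]
  congr 2
  have hd : (d.factorial : ℂ) ≠ 0 := Nat.cast_ne_zero.2 d.factorial_ne_zero
  rw [← hcard, Nat.cast_mul] at hd ⊢
  have h1 := left_ne_zero_of_mul hd
  have h2 := right_ne_zero_of_mul hd
  field_simp

/-- The average of `χ` against cycle monomials is an eigenvector. -/
theorem cutJoin_sum_char {d : ℕ} {χ : Equiv.Perm (Fin d) → ℂ} (hχ : IsIrredChar d χ) :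
    cutJoin d (∑ σ, χ σ • cardMonomial (cycles σ))
      = (2 * fChar χ) • ∑ σ, χ σ • cardMonomial (cycles σ) := by
  have hswap : ∀ t ∈ Finset.univ.filter (fun t : Equiv.Perm (Fin d) => t.IsSwap),
      ∑ σ, χ σ • cardMonomial (cycles (σ * t)) = ∑ σ, χ (σ * t) • cardMonomial (cycles σ) := by
    intro t ht
    obtain ⟨x, y, -, rfl⟩ := (Finset.mem_filter.1 ht).2
    refine Fintype.sum_equiv (Equiv.mulRight (Equiv.swap x y)) _ _ fun σ => ?_
    simp [mul_assoc]
  have hsum : ∑ σ, χ σ • ∑ t ∈ Finset.univ.filter (fun t : Equiv.Perm (Fin d) => t.IsSwap),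
        cardMonomial (cycles (σ * t))
      = fChar χ • ∑ σ, χ σ • cardMonomial (cycles σ) := by
    simp only [Finset.smul_sum]
    rw [Finset.sum_comm, Finset.sum_congr rfl hswap, Finset.sum_comm]
    refine Finset.sum_congr rfl fun σ _ => ?_
    rw [← Finset.sum_smul, sum_char_mul_swap hχ, smul_smul]
  simp only [map_sum, map_smul, cutJoin_cardMonomial_cycles, smul_comm _ (2 : ℕ)]
  rw [← Finset.smul_sum, hsum, mul_smul, two_smul, two_smul]

end DoubleHurwitz

open DoubleHurwitz MvPolynomial in
/-- **Cut-and-join eigenfunction identity.** The sum over ordered pairs `(i,j)` with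
`i, j ≥ 1` reduces to the finite sum over pairs with `i + j ≤ d`, since all other
terms vanish. -/
theorem cut_and_join_eigenfunction (d : ℕ) (hd : 0 < d)
    (rep : Nat.Partition d → Equiv.Perm (Fin d))
    (hrep : ∀ μ : Nat.Partition d, HasCycleType (rep μ) μ)
    (χ : Equiv.Perm (Fin d) → ℂ) (hχ : IsIrredChar d χ)
    (P : MvPolynomial ℕ ℂ)
    (hP : P = ∑ μ : Nat.Partition d,
        C (χ (rep μ) / (zPart μ : ℂ)) * (μ.parts.map fun i => (X i : MvPolynomial ℕ ℂ)).prod) :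
    C (fChar χ) * P
      = C (1 / 2 : ℂ) *
        ∑ ij ∈ (Finset.Icc 1 d ×ˢ Finset.Icc 1 d).filter (fun ij => ij.1 + ij.2 ≤ d),
          (C ((ij.1 + ij.2 : ℕ) : ℂ) * X ij.1 * X ij.2 * pderiv (ij.1 + ij.2) P
            + C ((ij.1 * ij.2 : ℕ) : ℂ) * X (ij.1 + ij.2) * pderiv ij.1 (pderiv ij.2 P)) := by
  have hP' := hP.trans (sum_partition_eq rep hrep hχ)
  change _ = C (1 / 2 : ℂ) * cutJoin d P
  rw [hP', map_smul, cutJoin_sum_char hχ, ← smul_eq_C_mul, ← smul_eq_C_mul, smul_smul, smul_smul,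
    smul_smul]
  congr 1
  ring
end
end

section
/- Exponential generating function interpretation: for every positive integer d, all partitions μ⁺, μ⁻ of d, and every λ ∈ ℂ, one has Φ•_{μ⁺,μ⁻}(λ) = Σ_{r=0}^∞ (λ^r / (r! · d!)) · N_r(μ⁺, μ⁻), where N_r(μ⁺, μ⁻) is the number of tuples (σ, τ_1, …, τ_r) ∈ (S_d)^{r+1} such that σ has cycle type μ⁺, each τ_i is a transposition, and σ·τ_1·⋯·τ_r has cycle type μ⁻; in particular the series converges absolutely for all λ. -/
open scoped BigOperators Classical

noncomputable section

namespace DoubleHurwitz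

/-- The number of tuples `(σ, τ_1, …, τ_r)` of permutations of `{1, …, d}` such that
`σ` has cycle type `μp`, each `τ_i` is a transposition, and the ordered product
`σ·τ_1·⋯·τ_r` has cycle type `μm`. -/
def Ntuples (d r : ℕ) (μp μm : Nat.Partition d) : ℕ :=
  (Finset.univ.filter
    (fun p : Equiv.Perm (Fin d) × (Fin r → Equiv.Perm (Fin d)) =>
      HasCycleType p.1 μp ∧ (∀ i : Fin r, (p.2 i).IsSwap) ∧
        HasCycleType (p.1 * (List.ofFn p.2).prod) μm)).card

end DoubleHurwitz

section CharacterExpansion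

open CategoryTheory MonoidAlgebra

universe u

lemma FDRep.char_one_ne_zero {k G : Type u} [Field k] [CharZero k] [Group G] (V : FDRep k G) [Simple V] :
    V.character 1 ≠ 0 := by
  rw [FDRep.char_one, Nat.cast_ne_zero]
  intro h
  have hs : Subsingleton V := Module.finrank_zero_iff.mp h
  apply id_nonzero V
  ext x
  exact Subsingleton.elim (α := V) _ _

variable {k G : Type u} [Field k] [IsAlgClosed k] [CharZero k] [Group G] [Fintype G]

lemma FDRep.simple_of_isIrreducible {V : Type u} [AddCommGroup V] [Module k V]
    [FiniteDimensional k V] (ρ : Representation k G V) [ρ.IsIrreducible] :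
    Simple (FDRep.of ρ) := by
  have := invertibleOfNonzero (NeZero.ne (Nat.card G : k))
  rw [FDRep.simple_iff_char_is_norm_one]
  have h := Representation.char_orthonormal ρ ρ
  rw [if_pos ⟨Representation.Equiv.refl ρ⟩, inv_mul_eq_one₀ (NeZero.ne _)] at h
  exact h.symm

/-- Schur's lemma: a class function acts on a simple representation by a scalar. -/
lemma FDRep.sum_smul_ρ_eq_smul_id (V : FDRep k G) [Simple V] (φ : G → k)
    (hφ : ∀ g h, φ (h * g * h⁻¹) = φ g) :
    ∑ g, φ g • V.ρ g = ((∑ g, φ g * V.character g) / V.character 1) • LinearMap.id := by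
  have hcomm (h : G) : (∑ g, φ g • V.ρ g) ∘ₗ V.ρ h = V.ρ h ∘ₗ ∑ g, φ g • V.ρ g := by
    simp only [← Module.End.mul_eq_comp, Finset.sum_mul, Finset.mul_sum, smul_mul_assoc,
      mul_smul_comm, ← map_mul]
    refine Fintype.sum_equiv (MulAut.conj h⁻¹).toEquiv _ _ fun g ↦ ?_
    have := hφ g h⁻¹
    simp_all [mul_assoc]
  let F : V ⟶ V := ⟨InducedCategory.homMk (ModuleCat.ofHom (∑ g, φ g • V.ρ g)), fun h ↦ by
    ext x
    exact LinearMap.congr_fun (hcomm h) x⟩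
  obtain ⟨c, hc⟩ := endomorphism_simple_eq_smul_id k F
  have hF : ∑ g, φ g • V.ρ g = c • LinearMap.id := by
    have := congrArg (fun f : V ⟶ V ↦ f.hom.hom.hom) hc
    exact this.symm
  have htr := congrArg (LinearMap.trace k V) hF
  simp only [map_sum, map_smul, smul_eq_mul, LinearMap.trace_id] at htr
  rw [hF]
  congr 1
  rw [eq_div_iff V.char_one_ne_zero, FDRep.char_one]
  exact htr.symm

/-- The character of a simple representation is an eigenfunction of the convolution with a class
function. -/
lemma FDRep.sum_mul_char_mul (V : FDRep k G) [Simple V] (φ : G → k)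
    (hφ : ∀ g h, φ (h * g * h⁻¹) = φ g) (x : G) :
    ∑ g, φ g * V.character (x * g) =
      ((∑ g, φ g * V.character g) / V.character 1) * V.character x := by
  have h := congrArg (fun f ↦ LinearMap.trace k V (V.ρ x * f)) (V.sum_smul_ρ_eq_smul_id φ hφ)
  simp only [Finset.mul_sum, mul_smul_comm, ← map_mul, map_sum, map_smul, smul_eq_mul] at h
  exact h

lemma Representation.asAlgebraHom_ofModule' {k G M : Type*} [CommSemiring k] [Monoid G]
    [AddCommMonoid M] [Module k M] [Module k[G] M] [IsScalarTower k k[G] M] :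
    Representation.asAlgebraHom (Representation.ofModule' (k := k) (G := G) M) =
      Algebra.lsmul k k M :=
  (MonoidAlgebra.lift k (M →ₗ[k] M) G).apply_symm_apply _

lemma Representation.isIrreducible_ofModule' {k G M : Type*} [Field k] [Monoid G]
    [AddCommGroup M] [Module k M] [Module k[G] M] [IsScalarTower k k[G] M]
    [IsSimpleModule k[G] M] :
    (Representation.ofModule' (k := k) (G := G) M).IsIrreducible := by
  rw [Representation.irreducible_iff_isSimpleModule_asModule]
  let e : (Representation.ofModule' (k := k) (G := G) M).asModule ≃ₗ[k[G]] M :=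
    { (Representation.ofModule' (k := k) (G := G) M).asModuleEquiv.toAddEquiv with
      map_smul' r x := by
        have h := (Representation.ofModule' (k := k) (G := G) M).asModuleEquiv_map_smul r x
        rw [Representation.asAlgebraHom_ofModule'] at h
        exact h }
  exact IsSimpleModule.congr e

/-- An element of the group algebra that kills every irreducible representation is zero. -/
lemma MonoidAlgebra.eq_zero_of_forall_simple (a : k[G])
    (ha : ∀ V : FDRep k G, Simple V → Representation.asAlgebraHom V.ρ a = 0) : a = 0 := by
  have : NeZero (Nat.card G : k) := ⟨NeZero.ne _⟩
  have key (x : k[G]) : a * x = 0 := by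
    have hx : x ∈ sSup {m : Submodule k[G] k[G] | IsSimpleModule k[G] m} := by
      rw [IsSemisimpleModule.sSup_simples_eq_top]
      trivial
    rw [sSup_eq_iSup'] at hx
    induction hx using Submodule.iSup_induction' with
    | zero => simp
    | add x y _ _ hx hy => rw [mul_add, hx, hy, add_zero]
    | mem S x hx =>
      obtain ⟨S, hS⟩ := S
      have : IsSimpleModule k[G] S := hS
      have := Representation.isIrreducible_ofModule' (k := k) (G := G) (M := S)
      have := FiniteDimensional.of_injective (S.subtype.restrictScalars k) S.subtype_injective
      have h := ha _ (FDRep.simple_of_isIrreducible (Representation.ofModule' (k := k) (G := G) S))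
      have h' : Representation.asAlgebraHom (Representation.ofModule' (k := k) (G := G) S) a = 0 :=
        h
      rw [Representation.asAlgebraHom_ofModule'] at h'
      exact congrArg Subtype.val (LinearMap.congr_fun h' ⟨x, hx⟩)
  simpa using key 1

/-- A class function orthogonal to all irreducible characters is zero. -/
lemma FDRep.eq_zero_of_sum_mul_char_eq_zero (φ : G → k) (hφ : ∀ g h, φ (h * g * h⁻¹) = φ g)
    (h : ∀ V : FDRep k G, Simple V → ∑ g, φ g * V.character g = 0) : φ = 0 := by
  have h0 : ∑ g, MonoidAlgebra.single g (φ g) = 0 := by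
    refine MonoidAlgebra.eq_zero_of_forall_simple _ fun V hV ↦ ?_
    simp only [map_sum, Representation.asAlgebraHom_single]
    rw [V.sum_smul_ρ_eq_smul_id φ hφ, h V hV]
    simp
  ext x
  have := congrArg (fun a ↦ a.coeff x) h0
  simpa [MonoidAlgebra.coeff_sum, Finsupp.finsetSum_apply, Finsupp.single_apply] using this

variable (k G) in
/-- The irreducible characters of `G` over `k`. -/
abbrev FDRep.IrreducibleCharacter : Type u :=
  {χ : G → k // ∃ V : FDRep k G, Simple V ∧ χ = V.character}

lemma FDRep.IrreducibleCharacter.inner_eq (χ ψ : FDRep.IrreducibleCharacter k G) :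
    (Nat.card G : k)⁻¹ * ∑ g, χ.1 g * ψ.1 g⁻¹ = if χ = ψ then 1 else 0 := by
  have := invertibleOfNonzero (NeZero.ne (Nat.card G : k))
  obtain ⟨_, V, hV, rfl⟩ := χ
  obtain ⟨_, W, hW, rfl⟩ := ψ
  have h := FDRep.char_orthonormal V W
  by_cases e : Nonempty (V ≅ W)
  · rw [h, if_pos e, if_pos (Subtype.ext (by exact FDRep.char_iso e.some))]
  · rw [if_neg e] at h
    rw [h, if_neg]
    intro he
    have hVW : V.character = W.character := congrArg Subtype.val he
    rw [← hVW, FDRep.char_orthonormal V V, if_pos ⟨Iso.refl V⟩] at h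
    exact one_ne_zero h

instance FDRep.IrreducibleCharacter.finite : Finite (FDRep.IrreducibleCharacter k G) := by
  refine LinearIndependent.finite (R := k) (f := fun χ : IrreducibleCharacter k G ↦ χ.1) ?_
  rw [linearIndependent_iff']
  intro s c hc ψ hψ
  have h : (Nat.card G : k)⁻¹ * ∑ g, (∑ χ ∈ s, c χ • χ.1) g * ψ.1 g⁻¹ = 0 := by
    rw [hc]
    simp
  simp only [Finset.sum_apply, Pi.smul_apply, smul_eq_mul, Finset.sum_mul] at h
  rw [Finset.sum_comm] at h
  simp only [mul_assoc, ← Finset.mul_sum] at h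
  rw [Finset.mul_sum] at h
  simp only [mul_left_comm _ (c _), inner_eq] at h
  simpa [hψ] using h

/-- The expansion of a class function in the basis of irreducible characters. -/
lemma FDRep.eq_sum_irreducibleCharacter [Fintype (FDRep.IrreducibleCharacter k G)] (φ : G → k)
    (hφ : ∀ g h, φ (h * g * h⁻¹) = φ g) (x : G) :
    φ x = ∑ χ : FDRep.IrreducibleCharacter k G,
      ((Nat.card G : k)⁻¹ * ∑ g, φ g * χ.1 g⁻¹) * χ.1 x := by
  set c : FDRep.IrreducibleCharacter k G → k :=
    fun χ ↦ (Nat.card G : k)⁻¹ * ∑ g, φ g * χ.1 g⁻¹ with hc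
  have hconj (χ : FDRep.IrreducibleCharacter k G) (g h : G) : χ.1 (h * g * h⁻¹) = χ.1 g := by
    obtain ⟨_, V, hV, rfl⟩ := χ
    exact V.char_conj g h
  have h0 : (fun g ↦ φ g⁻¹ - ∑ χ, c χ * χ.1 g⁻¹) = 0 := by
    refine FDRep.eq_zero_of_sum_mul_char_eq_zero _ (fun g h ↦ ?_) fun V hV ↦ ?_
    · have hinv : (h * g * h⁻¹)⁻¹ = h * g⁻¹ * h⁻¹ := by group
      simp only [hinv, hφ, hconj]
    · let ψ : FDRep.IrreducibleCharacter k G := ⟨V.character, V, hV, rfl⟩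
      change ∑ g, (φ g⁻¹ - ∑ χ, c χ * χ.1 g⁻¹) * ψ.1 g = 0
      rw [← Equiv.sum_comp (Equiv.inv G)]
      simp only [Equiv.inv_apply, inv_inv, sub_mul, Finset.sum_sub_distrib, Finset.sum_mul]
      rw [Finset.sum_comm]
      simp only [mul_assoc, ← Finset.mul_sum]
      have hN : (Nat.card G : k) ≠ 0 := NeZero.ne _
      have ho (χ : FDRep.IrreducibleCharacter k G) :
          ∑ g, χ.1 g * ψ.1 g⁻¹ = (Nat.card G : k) * if χ = ψ then 1 else 0 := by
        rw [← FDRep.IrreducibleCharacter.inner_eq, mul_inv_cancel_left₀ hN]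
      simp only [ho, mul_ite, mul_one, mul_zero, Finset.sum_ite_eq', Finset.mem_univ, if_true, hc]
      field_simp
      ring
  have := congrFun h0 x⁻¹
  simpa only [inv_inv, Pi.zero_apply, sub_eq_zero] using this

end CharacterExpansion

namespace DoubleHurwitz

section CycleType

variable {d : ℕ}

lemma cycleType_eq_filter_fullCycleType (σ : Equiv.Perm (Fin d)) :
    σ.cycleType = (fullCycleType σ).filter (2 ≤ ·) := by
  rw [fullCycleType, Multiset.filter_add,
    Multiset.filter_eq_self.2 fun _ ↦ Equiv.Perm.two_le_of_mem_cycleType,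
    Multiset.filter_eq_nil.2 fun a h ↦ ?_, add_zero]
  rw [Multiset.eq_of_mem_replicate h]
  decide

lemma isConj_iff_hasCycleType {σ τ : Equiv.Perm (Fin d)} {μ : Nat.Partition d}
    (hσ : HasCycleType σ μ) : IsConj σ τ ↔ HasCycleType τ μ := by
  rw [Equiv.Perm.isConj_iff_cycleType_eq]
  constructor <;> intro h
  · rwa [HasCycleType, fullCycleType, ← h]
  · rw [cycleType_eq_filter_fullCycleType, cycleType_eq_filter_fullCycleType τ, hσ, h]

lemma zPart_eq {σ : Equiv.Perm (Fin d)} {μ : Nat.Partition d} (hσ : HasCycleType σ μ) :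
    zPart μ = (d - σ.cycleType.sum).factorial * σ.cycleType.prod *
      ∏ n ∈ σ.cycleType.toFinset, (σ.cycleType.count n).factorial := by
  have hsub : σ.cycleType.toFinset ⊆ (Finset.Icc 1 d).erase 1 := by
    intro n hn
    rw [Multiset.mem_toFinset] at hn
    have h2 := Equiv.Perm.two_le_of_mem_cycleType hn
    have hle := Multiset.le_sum_of_mem hn
    have := σ.sum_cycleType_le
    simp at this
    simp
    omega
  have hcount (n : ℕ) (hn : n ≠ 1) : μ.parts.count n = σ.cycleType.count n := by
    rw [← hσ, fullCycleType, Multiset.count_add, Multiset.count_replicate, if_neg (Ne.symm hn),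
      add_zero]
  have hone : μ.parts.count 1 = d - σ.cycleType.sum := by
    rw [← hσ, fullCycleType, Multiset.count_add, Multiset.count_replicate_self,
      Multiset.count_eq_zero_of_notMem, zero_add]
    exact fun h ↦ absurd (Equiv.Perm.two_le_of_mem_cycleType h) (by norm_num)
  have herase : ∏ n ∈ (Finset.Icc 1 d).erase 1,
      (μ.parts.count n).factorial * n ^ μ.parts.count n =
      σ.cycleType.prod * ∏ n ∈ σ.cycleType.toFinset, (σ.cycleType.count n).factorial := by
    rw [Finset.prod_multiset_count, ← Finset.prod_mul_distrib, ← Finset.prod_subset hsub]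
    · refine Finset.prod_congr rfl fun n hn ↦ ?_
      rw [hcount n (Finset.ne_of_mem_erase (hsub hn)), mul_comm]
    · intro n hn hn'
      rw [hcount n (Finset.ne_of_mem_erase hn),
        Multiset.count_eq_zero_of_notMem (by simpa using hn')]
      simp
  rw [mul_assoc, ← herase, zPart]
  by_cases hd : 1 ∈ Finset.Icc 1 d
  · rw [← Finset.mul_prod_erase _ _ hd, hone, one_pow, mul_one]
  · have : d = 0 := by simpa using hd
    subst this
    simp

lemma card_hasCycleType_mul_zPart {σ : Equiv.Perm (Fin d)} {μ : Nat.Partition d}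
    (hσ : HasCycleType σ μ) :
    (Finset.univ.filter fun τ : Equiv.Perm (Fin d) ↦ HasCycleType τ μ).card * zPart μ =
      d.factorial := by
  have h := Equiv.Perm.card_isConj_mul_eq σ
  rw [Fintype.card_fin, ← zPart_eq hσ] at h
  rwa [Set.coe_ofPred, Nat.card_eq_fintype_card, Fintype.card_subtype,
    Finset.filter_congr fun τ _ ↦ isConj_iff_hasCycleType hσ] at h

end CycleType

/-- Iterating the eigenfunction equation of a function along words of length `r`. -/
lemma sum_words_eq {R G : Type*} [CommSemiring R] [Monoid G] [Fintype G] (P : G → Prop)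
    (χ : G → R) (c : R) (hχ : ∀ x, ∑ t, (if P t then χ (x * t) else 0) = c * χ x) (r : ℕ) (x : G) :
    ∑ τ : Fin r → G, (if ∀ i, P (τ i) then χ (x * (List.ofFn τ).prod) else 0) = c ^ r * χ x := by
  induction r generalizing x with
  | zero => simp
  | succ r ih =>
    rw [← (Fin.consEquiv fun _ ↦ G).sum_comp, Fintype.sum_prod_type]
    simp only [Fin.consEquiv_apply, Fin.forall_fin_succ, Fin.cons_zero, Fin.cons_succ,
      List.ofFn_succ, List.prod_cons, ite_and, ← mul_assoc]
    have (t : G) : ∑ τ : Fin r → G, (if P t then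
        if ∀ i, P (τ i) then χ (x * t * (List.ofFn τ).prod) else 0 else 0) =
        c ^ r * if P t then χ (x * t) else 0 := by
      split_ifs
      · exact ih _
      · simp
    simp only [this, ← Finset.mul_sum, hχ]
    ring

section Characters

variable {d : ℕ}

instance : Finite (IrredChar d) :=
  FDRep.IrreducibleCharacter.finite (k := ℂ) (G := Equiv.Perm (Fin d))

lemma IrredChar.apply_eq_of_isConj (χ : IrredChar d) {σ τ : Equiv.Perm (Fin d)}
    (h : IsConj σ τ) : χ.1 σ = χ.1 τ := by
  obtain ⟨_, V, hV, rfl⟩ := χ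
  obtain ⟨c, rfl⟩ := isConj_iff.mp h
  exact (V.char_conj σ c).symm

lemma IrredChar.sum_swap (χ : IrredChar d) (x : Equiv.Perm (Fin d)) :
    ∑ t : Equiv.Perm (Fin d), (if t.IsSwap then χ.1 (x * t) else 0) = fChar χ.1 * χ.1 x := by
  obtain ⟨_, V, hV, rfl⟩ := χ
  have hconj (g h : Equiv.Perm (Fin d)) : (h * g * h⁻¹).IsSwap ↔ g.IsSwap := by
    simp only [← Equiv.Perm.card_support_eq_two, Equiv.Perm.card_support_conj]
  have h := V.sum_mul_char_mul (fun t ↦ if t.IsSwap then 1 else 0)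
    (fun g h ↦ by simp only [hconj]) x
  simp only [ite_mul, one_mul, zero_mul] at h
  rw [h, fChar, ← Finset.sum_div, Finset.sum_filter]

variable [Fintype (IrredChar d)]

/-- The indicator function of a conjugacy class as a combination of irreducible characters. -/
lemma indicator_hasCycleType_eq_sum {σ : Equiv.Perm (Fin d)} {μ : Nat.Partition d}
    (hσ : HasCycleType σ μ) (x : Equiv.Perm (Fin d)) :
    (if HasCycleType x μ then 1 else 0 : ℂ) =
      ∑ χ : IrredChar d, χ.1 σ / zPart μ * χ.1 x := by
  let _ : Fintype (FDRep.IrreducibleCharacter ℂ (Equiv.Perm (Fin d))) :=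
    inferInstanceAs (Fintype (IrredChar d))
  have h := FDRep.eq_sum_irreducibleCharacter (k := ℂ)
    (fun x : Equiv.Perm (Fin d) ↦ if HasCycleType x μ then 1 else 0)
    (fun g h ↦ by
      have : IsConj (h * g * h⁻¹) g := (isConj_iff.mpr ⟨h, rfl⟩).symm
      simp only [← isConj_iff_hasCycleType hσ]
      exact if_congr ⟨fun e ↦ e.trans this, fun e ↦ e.trans this.symm⟩ rfl rfl) x
  refine h.trans (Finset.sum_congr rfl fun χ _ ↦ ?_)
  have hχ (g : Equiv.Perm (Fin d)) (hg : HasCycleType g μ) : χ.1 g⁻¹ = χ.1 σ := by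
    refine IrredChar.apply_eq_of_isConj χ ?_
    rw [isConj_comm, isConj_iff_hasCycleType hσ, HasCycleType, fullCycleType,
      Equiv.Perm.cycleType_inv]
    exact hg
  have hz : ((Finset.univ.filter fun τ : Equiv.Perm (Fin d) ↦ HasCycleType τ μ).card : ℂ) *
      zPart μ = d.factorial := mod_cast card_hasCycleType_mul_zPart hσ
  have hd : (d.factorial : ℂ) ≠ 0 := Nat.cast_ne_zero.mpr d.factorial_ne_zero
  have hz0 : (zPart μ : ℂ) ≠ 0 := fun h0 ↦ hd (by rw [← hz, h0, mul_zero])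
  congr 1
  simp only [ite_mul, one_mul, zero_mul, ← Finset.sum_filter]
  rw [Finset.sum_congr rfl fun g hg ↦ hχ g (Finset.mem_filter.mp hg).2, Finset.sum_const,
    nsmul_eq_mul, Nat.card_eq_fintype_card, Fintype.card_perm, Fintype.card_fin, ← hz]
  have hc0 := left_ne_zero_of_mul (hz ▸ hd)
  field_simp

/-- Frobenius' formula for the number of factorizations. -/
lemma Ntuples_eq_sum {σ τ : Equiv.Perm (Fin d)} {μ ν : Nat.Partition d}
    (hσ : HasCycleType σ μ) (hτ : HasCycleType τ ν) (r : ℕ) :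
    (Ntuples d r μ ν : ℂ) = d.factorial *
      ∑ χ : IrredChar d, χ.1 σ / zPart μ * (χ.1 τ / zPart ν) * fChar χ.1 ^ r := by
  have hz : ((Finset.univ.filter fun τ : Equiv.Perm (Fin d) ↦ HasCycleType τ μ).card : ℂ) *
      zPart μ = d.factorial := mod_cast card_hasCycleType_mul_zPart hσ
  have hd : (d.factorial : ℂ) ≠ 0 := Nat.cast_ne_zero.mpr d.factorial_ne_zero
  have hz0 : (zPart μ : ℂ) ≠ 0 := fun h0 ↦ hd (by rw [← hz, h0, mul_zero])
  have hwords (x : Equiv.Perm (Fin d)) : ∑ t : Fin r → Equiv.Perm (Fin d),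
      (if ∀ i, (t i).IsSwap then
        if HasCycleType (x * (List.ofFn t).prod) ν then 1 else 0 else 0 : ℂ) =
      ∑ χ : IrredChar d, χ.1 τ / zPart ν * (fChar χ.1 ^ r * χ.1 x) := by
    simp only [indicator_hasCycleType_eq_sum hτ, ← sum_words_eq _ _ _ (IrredChar.sum_swap _),
      Finset.mul_sum]
    rw [Finset.sum_comm]
    refine Finset.sum_congr rfl fun t _ ↦ ?_
    split_ifs <;> simp
  rw [Ntuples, Finset.card_filter, Nat.cast_sum, Fintype.sum_prod_type]
  simp only [Nat.cast_ite, Nat.cast_one, Nat.cast_zero, ite_and]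
  have hx (x : Equiv.Perm (Fin d)) : ∑ t : Fin r → Equiv.Perm (Fin d),
      (if HasCycleType x μ then if ∀ i, (t i).IsSwap then
        if HasCycleType (x * (List.ofFn t).prod) ν then 1 else 0 else 0 else 0 : ℂ) =
      if HasCycleType x μ then
        ∑ χ : IrredChar d, χ.1 τ / zPart ν * (fChar χ.1 ^ r * χ.1 σ) else 0 := by
    split_ifs with h
    · rw [hwords]
      refine Finset.sum_congr rfl fun χ _ ↦ ?_
      rw [χ.apply_eq_of_isConj ((isConj_iff_hasCycleType hσ).mpr h)]
    · simp
  simp only [hx]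
  rw [← Finset.sum_filter, Finset.sum_const, nsmul_eq_mul, ← hz, Finset.mul_sum, Finset.mul_sum]
  refine Finset.sum_congr rfl fun χ _ ↦ ?_
  field_simp

end Characters

end DoubleHurwitz

open DoubleHurwitz in
/-- **Exponential generating function interpretation of `Φ•`.** -/
theorem double_hurwitz_egf (d : ℕ) (hd : 0 < d)
    (rep : Nat.Partition d → Equiv.Perm (Fin d))
    (hrep : ∀ μ : Nat.Partition d, HasCycleType (rep μ) μ)
    (μp μm : Nat.Partition d) (lam : ℂ) :
    HasSum
      (fun r : ℕ =>
        lam ^ r / ((r.factorial : ℂ) * (d.factorial : ℂ)) * (Ntuples d r μp μm : ℂ))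
      (Phi rep μp μm lam) ∧
    Summable
      (fun r : ℕ =>
        ‖lam ^ r / ((r.factorial : ℂ) * (d.factorial : ℂ)) * (Ntuples d r μp μm : ℂ)‖) := by
  have hsum : HasSum
      (fun r : ℕ =>
        lam ^ r / ((r.factorial : ℂ) * (d.factorial : ℂ)) * (Ntuples d r μp μm : ℂ))
      (Phi rep μp μm lam) := by
    let _ : Fintype (IrredChar d) := Fintype.ofFinite _
    have hfact : (d.factorial : ℂ) ≠ 0 := Nat.cast_ne_zero.mpr d.factorial_ne_zero
    have h := hasSum_sum (s := Finset.univ) fun (χ : IrredChar d) _ ↦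
      (NormedSpace.expSeries_div_hasSum_exp (fChar χ.1 * lam)).mul_left
        (χ.1 (rep μp) / zPart μp * (χ.1 (rep μm) / zPart μm))
    rw [← Complex.exp_eq_exp_ℂ] at h
    rw [Phi, finsum_eq_sum_of_fintype]
    refine h.congr_fun fun r ↦ ?_
    rw [Ntuples_eq_sum (hrep μp) (hrep μm), Finset.mul_sum, Finset.mul_sum]
    refine Finset.sum_congr rfl fun χ _ ↦ ?_
    rw [mul_pow]
    field_simp
  exact ⟨hsum, hsum.summable.norm⟩
end
end
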